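/- Let 0 < k̲ < k̄, let φ_m(k) = k^{m−1} e^{k − (k̄ + k̲)/2} for m ≥ 1, and let N ≥ 1. Suppose Ψ_1, …, Ψ_N : [k̲, k̄] → ℝ are continuously differentiable functions that are orthonormal with respect to the inner product ⟨f, g⟩ = ∫_{k̲}^{k̄} f(k) g(k) dk, and such that for every m ≤ N, span{Ψ_1, …, Ψ_m} = span{φ_1, …, φ_m}. Define S_{mn} = ∫_{k̲}^{k̄} Ψ_n′(k) Ψ_m(k) dk for 1 ≤ m, n ≤ N. Then S_{mn} = 1 if n = m and S_{mn} = 0 if n < m. -/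

import Mathlib

open MeasureTheory

noncomputable section

/-- `φ_m(k) = k^(m-1) exp(k - (k̄+k̲)/2)`. -/
def phi (ka kb : ℝ) (m : ℕ) (k : ℝ) : ℝ := k ^ (m - 1) * Real.exp (k - (kb + ka) / 2)

/-- Restriction of a function on `ℝ` to the interval `[ka, kb]`. -/
def res (ka kb : ℝ) (f : ℝ → ℝ) : Set.Icc ka kb → ℝ := fun x => f x

theorem phi_hasDerivAt_sub_mem_span (ka kb : ℝ) {n j : ℕ} (hj : j ∈ Set.Icc 1 n) :
    ∃ D : ℝ → ℝ, (∀ k, HasDerivAt (phi ka kb j) (D k) k) ∧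
      res ka kb (fun k => D k - phi ka kb j k) ∈
        Submodule.span ℝ ((fun j => res ka kb (phi ka kb j)) '' Set.Icc 1 (n - 1)) := by
  refine ⟨fun k => ((j - 1 : ℕ) : ℝ) * k ^ (j - 1 - 1) * Real.exp (k - (kb + ka) / 2)
    + k ^ (j - 1) * Real.exp (k - (kb + ka) / 2), fun k => ?_, ?_⟩
  · have h : HasDerivAt (fun k => Real.exp (k - (kb + ka) / 2))
        (Real.exp (k - (kb + ka) / 2)) k := by
      simpa using ((hasDerivAt_id k).sub_const ((kb + ka) / 2)).exp
    exact (hasDerivAt_pow (j - 1) k).mul h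
  · have heq : res ka kb (fun k => ((j - 1 : ℕ) : ℝ) * k ^ (j - 1 - 1) *
          Real.exp (k - (kb + ka) / 2) + k ^ (j - 1) * Real.exp (k - (kb + ka) / 2) -
            phi ka kb j k) = ((j - 1 : ℕ) : ℝ) • res ka kb (phi ka kb (j - 1)) := by
      funext x
      simp only [res, phi, Pi.smul_apply, smul_eq_mul]
      ring
    rw [heq]
    rcases Nat.eq_zero_or_pos (j - 1) with h | h
    · simp [h]
    · exact Submodule.smul_mem _ _ (Submodule.subset_span
        ⟨j - 1, ⟨h, Nat.sub_le_sub_right hj.2 1⟩, rfl⟩)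

/-- On the span of `φ_1, …, φ_n`, differentiation minus the identity lowers the degree. -/
theorem exists_hasDerivAt_of_mem_span_phi (ka kb : ℝ) (n : ℕ) {g : Set.Icc ka kb → ℝ}
    (hg : g ∈ Submodule.span ℝ ((fun j => res ka kb (phi ka kb j)) '' Set.Icc 1 n)) :
    ∃ G D : ℝ → ℝ, res ka kb G = g ∧ (∀ k, HasDerivAt G (D k) k) ∧
      res ka kb (fun k => D k - G k) ∈
        Submodule.span ℝ ((fun j => res ka kb (phi ka kb j)) '' Set.Icc 1 (n - 1)) := by
  induction hg using Submodule.span_induction with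
  | mem x hx =>
    obtain ⟨j, hj, rfl⟩ := hx
    obtain ⟨D, hD, hmem⟩ := phi_hasDerivAt_sub_mem_span ka kb hj
    exact ⟨_, D, rfl, hD, hmem⟩
  | zero =>
    refine ⟨fun _ => 0, fun _ => 0, rfl, fun k => hasDerivAt_const k 0, ?_⟩
    convert Submodule.zero_mem _ using 1
    funext x
    simp [res]
  | add x y _ _ ihx ihy =>
    obtain ⟨G, D, rfl, hD, hmem⟩ := ihx
    obtain ⟨G', D', rfl, hD', hmem'⟩ := ihy
    refine ⟨fun k => G k + G' k, fun k => D k + D' k, rfl, fun k => (hD k).add (hD' k), ?_⟩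
    convert Submodule.add_mem _ hmem hmem' using 1
    funext x
    simp only [res, Pi.add_apply]
    ring
  | smul c x _ ih =>
    obtain ⟨G, D, rfl, hD, hmem⟩ := ih
    refine ⟨fun k => c * G k, fun k => c * D k, rfl, fun k => (hD k).const_mul c, ?_⟩
    convert Submodule.smul_mem _ c hmem using 1
    funext x
    simp only [res, Pi.smul_apply, smul_eq_mul]
    ring

/-- A function orthogonal to every `Ψ_j`, `j ∈ s`, is orthogonal to every function whose
restriction lies in their span. -/
theorem integral_mul_eq_zero_of_mem_span {ka kb : ℝ} {Ψ : ℕ → ℝ → ℝ} {f : ℝ → ℝ} {s : Set ℕ}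
    (hint : ∀ j ∈ s, IntegrableOn (fun k => Ψ j k * f k) (Set.Ioo ka kb))
    (hzero : ∀ j ∈ s, ∫ k in Set.Ioo ka kb, Ψ j k * f k = 0) {H : ℝ → ℝ}
    (hH : res ka kb H ∈ Submodule.span ℝ ((fun j => res ka kb (Ψ j)) '' s)) :
    IntegrableOn (fun k => H k * f k) (Set.Ioo ka kb) ∧
      ∫ k in Set.Ioo ka kb, H k * f k = 0 := by
  have key : ∃ G : ℝ → ℝ, res ka kb G = res ka kb H ∧
      IntegrableOn (fun k => G k * f k) (Set.Ioo ka kb) ∧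
        ∫ k in Set.Ioo ka kb, G k * f k = 0 := by
    generalize res ka kb H = g at hH ⊢
    induction hH using Submodule.span_induction with
    | mem x hx =>
      obtain ⟨j, hj, rfl⟩ := hx
      exact ⟨Ψ j, rfl, hint j hj, hzero j hj⟩
    | zero => exact ⟨fun _ => 0, rfl, by simp, by simp⟩
    | add x y _ _ ihx ihy =>
      obtain ⟨G, rfl, hi, hz⟩ := ihx
      obtain ⟨G', rfl, hi', hz'⟩ := ihy
      refine ⟨fun k => G k + G' k, rfl, ?_, ?_⟩
      · simp only [add_mul]
        exact hi.add hi'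
      · simp only [add_mul]
        rw [integral_add hi hi', hz, hz', add_zero]
    | smul c x _ ih =>
      obtain ⟨G, rfl, hi, hz⟩ := ih
      refine ⟨fun k => c * G k, rfl, ?_, ?_⟩
      · simp only [mul_assoc]
        exact hi.const_mul c
      · simp only [mul_assoc]
        rw [integral_const_mul, hz, mul_zero]
  obtain ⟨G, hG, hi, hz⟩ := key
  have heq : Set.EqOn (fun k => G k * f k) (fun k => H k * f k) (Set.Ioo ka kb) := fun k hk => by
    have := congrFun hG ⟨k, Set.Ioo_subset_Icc_self hk⟩
    simp only [res] at this
    simp only [this]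
  exact ⟨hi.congr_fun heq measurableSet_Ioo,
    by rw [← setIntegral_congr_fun measurableSet_Ioo heq, hz]⟩

/-- For the Gram–Schmidt orthonormalization `Ψ_n` of the family `φ_n`, the matrix
`S_{mn} = ⟨Ψ_n', Ψ_m⟩` satisfies `S_{mn} = 1` if `n = m` and `S_{mn} = 0` if `n < m`. -/
theorem smatrix_triangular (ka kb : ℝ) (h0 : 0 < ka) (hab : ka < kb)
    (N : ℕ) (hN : 1 ≤ N) (Ψ DΨ : ℕ → ℝ → ℝ)
    (hdiff : ∀ n, 1 ≤ n → n ≤ N → ∀ k ∈ Set.Icc ka kb,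
        HasDerivWithinAt (Ψ n) (DΨ n k) (Set.Icc ka kb) k)
    (hcont : ∀ n, 1 ≤ n → n ≤ N → ContinuousOn (DΨ n) (Set.Icc ka kb))
    (horth : ∀ m, 1 ≤ m → m ≤ N → ∀ n, 1 ≤ n → n ≤ N →
        (∫ k in Set.Ioo ka kb, Ψ m k * Ψ n k) = if m = n then 1 else 0)
    (hspan : ∀ m, 1 ≤ m → m ≤ N →
        Submodule.span ℝ ((fun j => res ka kb (Ψ j)) '' Set.Icc 1 m) =
        Submodule.span ℝ ((fun j => res ka kb (phi ka kb j)) '' Set.Icc 1 m)) :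
    ∀ m, 1 ≤ m → m ≤ N → ∀ n, 1 ≤ n → n ≤ N →
      (n = m → (∫ k in Set.Ioo ka kb, DΨ n k * Ψ m k) = 1) ∧
      (n < m → (∫ k in Set.Ioo ka kb, DΨ n k * Ψ m k) = 0) := by
  have hc : ∀ n, 1 ≤ n → n ≤ N → ContinuousOn (Ψ n) (Set.Icc ka kb) := fun n h1 h2 k hk =>
    (hdiff n h1 h2 k hk).continuousWithinAt
  have hint : ∀ m, 1 ≤ m → m ≤ N → ∀ n, 1 ≤ n → n ≤ N →
      IntegrableOn (fun k => Ψ n k * Ψ m k) (Set.Ioo ka kb) := fun m h1 h2 n h3 h4 =>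
    (((hc n h3 h4).mul (hc m h1 h2)).integrableOn_Icc).mono_set Set.Ioo_subset_Icc_self
  intro m hm1 hmN n hn1 hnN
  have hmem : res ka kb (Ψ n) ∈
      Submodule.span ℝ ((fun j => res ka kb (phi ka kb j)) '' Set.Icc 1 n) := by
    rw [← hspan n hn1 hnN]
    exact Submodule.subset_span ⟨n, ⟨hn1, le_rfl⟩, rfl⟩
  obtain ⟨G, D, hG, hD, hlow⟩ := exists_hasDerivAt_of_mem_span_phi ka kb n hmem
  have hGΨ : ∀ k ∈ Set.Icc ka kb, G k = Ψ n k := fun k hk => congrFun hG ⟨k, hk⟩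
  have hDΨ : ∀ k ∈ Set.Icc ka kb, D k = DΨ n k := fun k hk =>
    (uniqueDiffOn_Icc hab k hk).eq_deriv _
      ((hD k).hasDerivWithinAt.congr (fun x hx => (hGΨ x hx).symm) (hGΨ k hk).symm)
      (hdiff n hn1 hnN k hk)
  have hlowΨ : res ka kb (fun k => D k - G k) ∈
      Submodule.span ℝ ((fun j => res ka kb (Ψ j)) '' Set.Icc 1 (n - 1)) := by
    rcases Nat.eq_zero_or_pos (n - 1) with h | h
    · simpa [h] using hlow
    · rwa [hspan (n - 1) h (by omega)]
  have hval : n ≤ m → ∫ k in Set.Ioo ka kb, DΨ n k * Ψ m k = if n = m then 1 else 0 := by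
    intro hnm
    obtain ⟨hi, hz⟩ := integral_mul_eq_zero_of_mem_span (f := Ψ m) (s := Set.Icc 1 (n - 1))
      (fun j hj => hint m hm1 hmN j hj.1 (by have := hj.2; omega))
      (fun j hj => by
        have := hj.2
        rw [horth j hj.1 (by omega) m hm1 hmN, if_neg (by omega)]) hlowΨ
    have heq : Set.EqOn (fun k => DΨ n k * Ψ m k)
        (fun k => Ψ n k * Ψ m k + (D k - G k) * Ψ m k) (Set.Ioo ka kb) := fun k hk => by
      have hk' := Set.Ioo_subset_Icc_self hk
      simp only [hDΨ k hk', hGΨ k hk']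
      ring
    rw [setIntegral_congr_fun measurableSet_Ioo heq,
      integral_add (hint m hm1 hmN n hn1 hnN) hi, hz, horth n hn1 hnN m hm1 hmN, add_zero]
  exact ⟨fun h => by rw [hval h.le, if_pos h], fun h => by rw [hval h.le, if_neg h.ne]⟩
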